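/- Let K be a linearly ordered field, let X be a 2×4 matrix over K that represents the uniform matroid U_{2,4}, i.e. all six of its 2×2 maximal minors are nonzero, and let k be a non-negative integer with k ≠ 1. Then there is no 2×4 matrix X_k over K such that |Δ_I(X_k)| = |Δ_I(X)|^k holds for all six 2-element subsets I of the column indices. -/

import Mathlib

/-- The maximal minor of a `d × N` matrix indexed by a `d`-element set `I` of column
indices: the determinant of the square submatrix consisting of the columns in `I`
(taken in increasing order). Junk value `0` if `I.card ≠ d`. -/
noncomputable def maxMinor {K : Type*} [CommRing K] {d N : ℕ}
    (X : Matrix (Fin d) (Fin N) K) (I : Finset (Fin N)) : K :=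
  if h : I.card = d then
    (X.submatrix id (fun j : Fin d => ((I.orderIsoOfFin h) j).val)).det
  else 0

/-- A matrix is totally unimodular if every square submatrix has determinant `0`, `1` or `-1`. -/
def IsTotUnimod {K : Type*} [CommRing K] {d N : ℕ} (A : Matrix (Fin d) (Fin N) K) : Prop :=
  ∀ (k : ℕ) (f : Fin k → Fin d) (g : Fin k → Fin N), Function.Injective f → Function.Injective g →
    (A.submatrix f g).det = 0 ∨ (A.submatrix f g).det = 1 ∨ (A.submatrix f g).det = -1

/-- A `d × N` matrix of full rank `d` represents a regular matroid if there is a totally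
unimodular matrix with the same pattern of vanishing maximal minors. -/
def RepresentsRegular {K : Type*} [CommRing K] {d N : ℕ} (X : Matrix (Fin d) (Fin N) K) : Prop :=
  ∃ A : Matrix (Fin d) (Fin N) K, IsTotUnimod A ∧
    ∀ I : Finset (Fin N), I.card = d → (maxMinor X I = 0 ↔ maxMinor A I = 0)

theorem maxMinor_pair {K : Type*} [CommRing K] (X : Matrix (Fin 2) (Fin 4) K)
    (i j : Fin 4) (hij : i < j) :
    maxMinor X {i, j} = X 0 i * X 1 j - X 0 j * X 1 i := by
  have hc : ({i, j} : Finset (Fin 4)).card = 2 := Finset.card_pair hij.ne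
  have hf : (![i, j] : Fin 2 → Fin 4) = ({i, j} : Finset (Fin 4)).orderEmbOfFin hc := by
    apply Finset.orderEmbOfFin_unique
    · intro x
      fin_cases x <;> simp
    · intro x y hxy
      fin_cases x <;> fin_cases y <;> simp_all
  have h0 : ({i, j} : Finset (Fin 4)).orderEmbOfFin hc 0 = i := by rw [← hf]; rfl
  have h1 : ({i, j} : Finset (Fin 4)).orderEmbOfFin hc 1 = j := by rw [← hf]; rfl
  unfold maxMinor
  rw [dif_pos hc, Matrix.det_fin_two]
  simp only [Matrix.submatrix_apply, id, Finset.coe_orderIsoOfFin_apply, h0, h1]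

theorem add_pow_lt_aux {K : Type*} [Field K] [LinearOrder K] [IsStrictOrderedRing K]
    (b c : K) (hb : 0 < b) (hc : 0 < c) (n : ℕ) :
    b ^ (n + 2) + c ^ (n + 2) < (b + c) ^ (n + 2) := by
  induction n with
  | zero =>
    simp only [zero_add]
    nlinarith [mul_pos hb hc]
  | succ n ih =>
    have h1 := mul_lt_mul_of_pos_right ih (add_pos hb hc)
    have h2 := mul_pos (pow_pos hb (n + 2)) hc
    have h3 := mul_pos (pow_pos hc (n + 2)) hb
    have e : ∀ x : K, x ^ (n + 1 + 2) = x ^ (n + 2) * x := fun x => pow_succ x (n + 2)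
    rw [e, e, e]
    linarith

theorem pow_no_rel {K : Type*} [Field K] [LinearOrder K] [IsStrictOrderedRing K]
    (b c : K) (hb : 0 < b) (hc : 0 < c) (k : ℕ) (hk : k ≠ 1) :
    (b + c) ^ k ≠ b ^ k + c ^ k ∧ b ^ k ≠ (b + c) ^ k + c ^ k ∧
      c ^ k ≠ (b + c) ^ k + b ^ k := by
  have h1 : b ^ k ≤ (b + c) ^ k := pow_le_pow_left₀ hb.le (by linarith) k
  have h2 : c ^ k ≤ (b + c) ^ k := pow_le_pow_left₀ hc.le (by linarith) k
  have h3 := pow_pos hb k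
  have h4 := pow_pos hc k
  refine ⟨?_, by intro h; linarith, by intro h; linarith⟩
  match k, hk with
  | 0, _ => simp
  | 1, h => exact absurd rfl h
  | n + 2, _ => exact (add_pow_lt_aux b c hb hc n).ne'

theorem abs_rel {K : Type*} [Field K] [LinearOrder K] [IsStrictOrderedRing K]
    (x y z : K) (h : x + z = y) :
    |y| = |x| + |z| ∨ |x| = |y| + |z| ∨ |z| = |y| + |x| := by
  rcases abs_cases x with ⟨hx, _⟩ | ⟨hx, _⟩ <;> rcases abs_cases y with ⟨hy, _⟩ | ⟨hy, _⟩ <;>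
    rcases abs_cases z with ⟨hz, _⟩ | ⟨hz, _⟩ <;> rw [hx, hy, hz] <;>
    first
    | (left; linarith)
    | (right; left; linarith)
    | (right; right; linarith)

theorem core_rel {K : Type*} [Field K] [LinearOrder K] [IsStrictOrderedRing K]
    (x y z u v w : K) (hx : x ≠ 0) (hy : y ≠ 0) (hz : z ≠ 0) (h : x + z = y) (h' : u + w = v)
    (k : ℕ) (hk : k ≠ 1) (hu : |u| = |x| ^ k) (hv : |v| = |y| ^ k) (hw : |w| = |z| ^ k) :
    False := by
  have px := abs_pos.mpr hx
  have py := abs_pos.mpr hy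
  have pz := abs_pos.mpr hz
  have r := abs_rel u v w h'
  rw [hu, hv, hw] at r
  rcases abs_rel x y z h with e | e | e
  · obtain ⟨t1, t2, t3⟩ := pow_no_rel _ _ px pz k hk
    rw [← e] at t1 t2 t3
    grind
  · obtain ⟨t1, t2, t3⟩ := pow_no_rel _ _ py pz k hk
    rw [← e] at t1 t2 t3
    grind
  · obtain ⟨t1, t2, t3⟩ := pow_no_rel _ _ py px k hk
    rw [← e] at t1 t2 t3
    grind

/-- **Lemma 5.1 (ii), ordered field case.** If a `2 × 4` matrix `X` over a linearly ordered
field represents `U_{2,4}` (all six maximal minors are nonzero) and `k` is a non-negative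
integer with `k ≠ 1`, then no `2 × 4` matrix `X_k` over `K` satisfies
`|Δ_I(X_k)| = |Δ_I(X)|^k` for all six `I`. -/
theorem no_kth_power_U24_ordered_field {K : Type*} [Field K] [LinearOrder K] [IsStrictOrderedRing K]
    (X : Matrix (Fin 2) (Fin 4) K)
    (hU : ∀ I : Finset (Fin 4), I.card = 2 → maxMinor X I ≠ 0)
    (k : ℕ) (hk1 : k ≠ 1) :
    ¬ ∃ Xk : Matrix (Fin 2) (Fin 4) K, ∀ I : Finset (Fin 4), I.card = 2 →
        |maxMinor Xk I| = |maxMinor X I| ^ k := by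
  rintro ⟨Y, hY⟩
  have hX0 : ∀ i j : Fin 4, i < j → X 0 i * X 1 j - X 0 j * X 1 i ≠ 0 := by
    intro i j hij
    rw [← maxMinor_pair X i j hij]
    exact hU _ (Finset.card_pair hij.ne)
  have hXY : ∀ i j : Fin 4, i < j →
      |Y 0 i * Y 1 j - Y 0 j * Y 1 i| = |X 0 i * X 1 j - X 0 j * X 1 i| ^ k := by
    intro i j hij
    rw [← maxMinor_pair X i j hij, ← maxMinor_pair Y i j hij]
    exact hY _ (Finset.card_pair hij.ne)
  have hm : ∀ a b c d : Fin 4, a < b → c < d →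
      |(Y 0 a * Y 1 b - Y 0 b * Y 1 a) * (Y 0 c * Y 1 d - Y 0 d * Y 1 c)| =
      |(X 0 a * X 1 b - X 0 b * X 1 a) * (X 0 c * X 1 d - X 0 d * X 1 c)| ^ k := by
    intro a b c d h1 h2
    rw [abs_mul, abs_mul, mul_pow, hXY a b h1, hXY c d h2]
  exact core_rel _ _ _ _ _ _
    (mul_ne_zero (hX0 0 1 (by decide)) (hX0 2 3 (by decide)))
    (mul_ne_zero (hX0 0 2 (by decide)) (hX0 1 3 (by decide)))
    (mul_ne_zero (hX0 0 3 (by decide)) (hX0 1 2 (by decide)))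
    (by ring) (by ring) k hk1
    (hm 0 1 2 3 (by decide) (by decide))
    (hm 0 2 1 3 (by decide) (by decide))
    (hm 0 3 1 2 (by decide) (by decide))
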